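/- For every complete finitely ambiguous NBW A over Σ with n states, there exists an NBW B over Σ with at most 6^n states such that L(B) = Σ^ω ∖ L(A), i.e., B accepts exactly the ω-words not accepted by A. -/

import Mathlib

open scoped Classical

/-- A nondeterministic Büchi automaton on ω-words with states `Q` over alphabet `σ`. -/
structure NBW (σ : Type) (Q : Type) where
  init : Set Q
  trans : Q → σ → Set Q
  acc : Set Q

namespace NBW

variable {σ Q : Type}

/-- `ρ` is a run of `A` on the ω-word `w`. -/
def IsRun (A : NBW σ Q) (w : ℕ → σ) (ρ : ℕ → Q) : Prop :=
  ρ 0 ∈ A.init ∧ ∀ i, ρ (i + 1) ∈ A.trans (ρ i) (w i)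

/-- `ρ` is an accepting run of `A` on `w`: it visits `A.acc` infinitely often. -/
def IsAccRun (A : NBW σ Q) (w : ℕ → σ) (ρ : ℕ → Q) : Prop :=
  A.IsRun w ρ ∧ ∀ n, ∃ m, n ≤ m ∧ ρ m ∈ A.acc

/-- The ω-language accepted by `A`. -/
def Lang (A : NBW σ Q) : Set (ℕ → σ) := {w | ∃ ρ, A.IsAccRun w ρ}

/-- `A` is complete: every state has a successor on every letter. -/
def Complete (A : NBW σ Q) : Prop := ∀ q a, (A.trans q a).Nonempty

/-- `A` is finitely ambiguous: every accepted word has finitely many accepting runs. -/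
def FinitelyAmbiguous (A : NBW σ Q) : Prop :=
  ∀ w ∈ A.Lang, {ρ | A.IsAccRun w ρ}.Finite

/-- `A` is limit deterministic with partition `(QN, QD)`. -/
def LimitDetPart (A : NBW σ Q) (QN QD : Set Q) : Prop :=
  Disjoint QN QD ∧ QN ∪ QD = Set.univ ∧ A.acc ⊆ QD ∧
    ∀ q ∈ QD, ∀ a, ∃ q' ∈ QD, A.trans q a = {q'}

/-- `A` is limit deterministic (for some partition). -/
def LimitDet (A : NBW σ Q) : Prop := ∃ QN QD, A.LimitDetPart QN QD

end NBW

namespace NBW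

variable {σ Q : Type}

/-- Subset construction step. -/
def fStep (A : NBW σ Q) (S : Set Q) (a : σ) : Set Q := {q' | ∃ q ∈ S, q' ∈ A.trans q a}

/-- A fixed choice of predecessor. -/
noncomputable def fPar (A : NBW σ Q) (S : Set Q) (a : σ) (q' : Q) : Q :=
  if h : ∃ q ∈ S, q' ∈ A.trans q a then h.choose else q'

theorem fPar_spec (A : NBW σ Q) {S : Set Q} {a : σ} {q' : Q} (h : q' ∈ A.fStep S a) :
    A.fPar S a q' ∈ S ∧ q' ∈ A.trans (A.fPar S a q') a := by
  have h' : ∃ q ∈ S, q' ∈ A.trans q a := h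
  unfold fPar
  rw [dif_pos h']
  exact h'.choose_spec

/-- Reachable sets. -/
def fReach (A : NBW σ Q) (w : ℕ → σ) : ℕ → Set Q
  | 0 => A.init
  | i + 1 => A.fStep (fReach A w i) (w i)

/-- The forest path ending in `q` at level `j`. -/
noncomputable def fPath (A : NBW σ Q) (w : ℕ → σ) : ℕ → Q → ℕ → Q
  | 0, q, _ => q
  | j + 1, q, i => if i ≤ j then fPath A w j (A.fPar (A.fReach w j) (w j) q) i else q

theorem fPath_self (A : NBW σ Q) (w : ℕ → σ) (j : ℕ) (q : Q) : A.fPath w j q j = q := by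
  cases j <;> simp [fPath]

theorem fPath_mem (A : NBW σ Q) (w : ℕ → σ) (j : ℕ) : ∀ q ∈ A.fReach w j, ∀ i ≤ j,
    A.fPath w j q i ∈ A.fReach w i := by
  induction j with
  | zero =>
    intro q hq i hi
    obtain rfl : i = 0 := by omega
    exact hq
  | succ j ih =>
    intro q hq i hi
    by_cases h : i ≤ j
    · simp only [fPath, h, if_true]
      exact ih _ (A.fPar_spec hq).1 i h
    · obtain rfl : i = j + 1 := by omega
      rw [fPath_self]; exact hq

theorem fPath_trans (A : NBW σ Q) (w : ℕ → σ) (j : ℕ) : ∀ q ∈ A.fReach w j, ∀ i < j,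
    A.fPath w j q (i + 1) ∈ A.trans (A.fPath w j q i) (w i) := by
  induction j with
  | zero => intro q hq i hi; omega
  | succ j ih =>
    intro q hq i hi
    by_cases h : i < j
    · have h1 : i + 1 ≤ j := h
      have h2 : i ≤ j := h.le
      simp only [fPath, h1, h2, if_true]
      exact ih _ (A.fPar_spec hq).1 i h
    · obtain rfl : i = j := by omega
      rw [fPath_self]
      simp only [fPath, le_refl, if_true]
      rw [fPath_self]
      exact (A.fPar_spec hq).2

/-- Deterministic breakpoint step in the second phase. -/
noncomputable def fNext (A : NBW σ Q) (f : Q → Fin 4) (a : σ) (q : Q) : Fin 4 :=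
  if q ∈ A.fStep {q | f q ≠ 0} a then
    if 2 ≤ f (A.fPar {q | f q ≠ 0} a q) ∨ q ∈ A.acc then
      if (∀ p, f p ≠ 3) ∨ f (A.fPar {q | f q ≠ 0} a q) = 3 then 3 else 2
    else 1
  else 0

noncomputable def fInd (S : Set Q) (q : Q) : Fin 4 := if q ∈ S then 1 else 0

theorem fInd_supp (S : Set Q) : {q | fInd S q ≠ 0} = S := by
  ext q; by_cases h : q ∈ S <;> simp [fInd, h]

theorem fNext_supp (A : NBW σ Q) (f : Q → Fin 4) (a : σ) :
    {q | A.fNext f a q ≠ 0} = A.fStep {q | f q ≠ 0} a := by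
  ext q
  simp only [Set.mem_ofPred_eq, fNext]
  split_ifs with h1 h2 h3 <;> simp [h1]

/-- The complement automaton. -/
noncomputable def fComp (A : NBW σ Q) : NBW σ (Set Q ⊕ (Q → Fin 4)) where
  init := {Sum.inl A.init}
  trans s a := match s with
    | Sum.inl S => {Sum.inl (A.fStep S a), Sum.inr (fInd (A.fStep S a))}
    | Sum.inr f => {Sum.inr (A.fNext f a)}
  acc := {s | ∃ f, s = Sum.inr f ∧ ∀ q, f q ≠ 3}

theorem run_mem_reach (A : NBW σ Q) {w : ℕ → σ} {ρ : ℕ → Q} (h : A.IsRun w ρ) (i : ℕ) :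
    ρ i ∈ A.fReach w i := by
  induction i with
  | zero => exact h.1
  | succ i ih => exact ⟨_, ih, h.2 i⟩

theorem eventually_unique (A : NBW σ Q) (hfa : A.FinitelyAmbiguous) {w : ℕ → σ} {ρ : ℕ → Q}
    (h : A.IsAccRun w ρ) :
    ∃ N, ∀ i ≥ N, ∀ q ∈ A.fReach w i, ρ (i + 1) ∈ A.trans q (w i) → q = ρ i := by
  by_contra hcon
  push Not at hcon
  have key : ∀ N, ∃ i, N ≤ i ∧ ∃ ρ', A.IsAccRun w ρ' ∧ ρ' i ≠ ρ i ∧ ∀ j, i < j → ρ' j = ρ j := by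
    intro N
    obtain ⟨i, hi, q, hq, ht, hne⟩ := hcon N
    refine ⟨i, hi, fun j => if j ≤ i then A.fPath w i q j else ρ j, ⟨⟨?_, ?_⟩, ?_⟩, ?_, ?_⟩
    · simpa [fReach] using A.fPath_mem w i q hq 0 (Nat.zero_le _)
    · intro j
      rcases lt_trichotomy j i with hj | rfl | hj
      · have h1 : j + 1 ≤ i := hj
        have h2 : j ≤ i := hj.le
        simp only [h1, h2, if_true]
        exact A.fPath_trans w i q hq j hj
      · simp only [le_refl, if_true, fPath_self]
        simpa using ht
      · have h1 : ¬ j + 1 ≤ i := by omega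
        have h2 : ¬ j ≤ i := by omega
        simp only [h1, h2, if_false]
        exact h.1.2 j
    · intro n
      obtain ⟨m, hm, hm'⟩ := h.2 (max n (i + 1))
      refine ⟨m, by omega, ?_⟩
      have : ¬ m ≤ i := by omega
      simpa [this] using hm'
    · simpa [fPath_self] using hne
    · intro j hj
      have : ¬ j ≤ i := by omega
      simp [this]
  let I : Set ℕ := {i | ∃ ρ', A.IsAccRun w ρ' ∧ ρ' i ≠ ρ i ∧ ∀ j, i < j → ρ' j = ρ j}
  have hI : I.Infinite := by
    rw [Set.infinite_iff_exists_gt]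
    intro N
    obtain ⟨i, hi, h'⟩ := key (N + 1)
    exact ⟨i, h', by omega⟩
  have hex : ∀ i, ∃ ρ', i ∈ I → A.IsAccRun w ρ' ∧ ρ' i ≠ ρ i ∧ ∀ j, i < j → ρ' j = ρ j := by
    intro i
    by_cases hi : i ∈ I
    · obtain ⟨ρ', h'⟩ := hi
      exact ⟨ρ', fun _ => h'⟩
    · exact ⟨ρ, fun h => absurd h hi⟩
  choose F hF using hex
  have hinj : Set.InjOn F I := by
    intro i hi j hj hij
    rcases lt_trichotomy i j with hlt | heq | hlt
    · exact absurd ((hij ▸ (hF i hi).2.2 j hlt)) (hF j hj).2.1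
    · exact heq
    · exact absurd ((hij ▸ (hF j hj).2.2 i hlt)) (hF i hi).2.1
  exact Set.infinite_of_injOn_mapsTo hinj (fun i hi => (hF i hi).1) hI (hfa w ⟨ρ, h⟩)

theorem comp_sound (A : NBW σ Q) (hfa : A.FinitelyAmbiguous) {w : ℕ → σ}
    (hw : w ∈ A.fComp.Lang) : w ∉ A.Lang := by
  rintro ⟨ρ, hρ⟩
  obtain ⟨r, hr, hacc⟩ := hw
  obtain ⟨N, hN⟩ := A.eventually_unique hfa hρ
  have inv : ∀ i, r i = Sum.inl (A.fReach w i) ∨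
      ∃ f, r i = Sum.inr f ∧ {q | f q ≠ 0} = A.fReach w i := by
    intro i
    induction i with
    | zero => left; exact hr.1
    | succ i ih =>
      have ht := hr.2 i
      rcases ih with ih | ⟨f, ih, hf⟩
      · rw [ih] at ht
        rcases ht with ht | ht
        · left; exact ht
        · right; exact ⟨_, ht, fInd_supp _⟩
      · rw [ih] at ht
        right
        exact ⟨_, ht, by rw [fNext_supp, hf]; rfl⟩
  -- good levels
  have step : ∀ i f, r i = Sum.inr f → r (i + 1) = Sum.inr (A.fNext f (w i)) := by
    intro i f h
    have ht := hr.2 i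
    rw [h] at ht
    exact ht
  have supp : ∀ i f, r i = Sum.inr f → {q | f q ≠ 0} = A.fReach w i := by
    intro i f h
    rcases inv i with h' | ⟨f', h', hf⟩
    · rw [h] at h'; cases h'
    · rw [h] at h'; cases h'; exact hf
  have val : ∀ i ≥ N, ∀ f, r i = Sum.inr f → A.fNext f (w i) (ρ (i + 1)) =
      if 2 ≤ f (ρ i) ∨ ρ (i + 1) ∈ A.acc then
        if (∀ p, f p ≠ 3) ∨ f (ρ i) = 3 then 3 else 2
      else 1 := by
    intro i hi f h
    have hs := supp i f h
    have hm : ρ (i + 1) ∈ A.fStep (A.fReach w i) (w i) := A.run_mem_reach hρ.1 (i + 1)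
    have hp : A.fPar (A.fReach w i) (w i) (ρ (i + 1)) = ρ i :=
      hN i hi _ (A.fPar_spec hm).1 (A.fPar_spec hm).2
    unfold fNext
    rw [hs, hp, if_pos hm]
  obtain ⟨k, hk, f0, hf0, -⟩ := hacc N
  have inr : ∀ i ≥ k, ∃ f, r i = Sum.inr f := by
    intro i hi
    induction i, hi using Nat.le_induction with
    | base => exact ⟨f0, hf0⟩
    | succ i hi ih => obtain ⟨f, hf⟩ := ih; exact ⟨_, step i f hf⟩
  obtain ⟨m, hm, hmacc⟩ := hρ.2 (k + 1)
  obtain ⟨m, rfl⟩ : ∃ m', m = m' + 1 := ⟨m - 1, by omega⟩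
  have two : ∀ i ≥ m + 1, ∃ f, r i = Sum.inr f ∧ 2 ≤ f (ρ i) := by
    intro i hi
    induction i, hi using Nat.le_induction with
    | base =>
      obtain ⟨f, hf⟩ := inr m (by omega)
      refine ⟨_, step m f hf, ?_⟩
      rw [val m (by omega) f hf, if_pos (Or.inr hmacc)]
      split_ifs <;> decide
    | succ i hi ih =>
      obtain ⟨f, hf, h2⟩ := ih
      refine ⟨_, step i f hf, ?_⟩
      rw [val i (by omega) f hf, if_pos (Or.inl h2)]
      split_ifs <;> decide
  obtain ⟨j, hj, f1, hf1, hempty⟩ := hacc (m + 1)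
  have three : ∀ i ≥ j + 1, ∃ f, r i = Sum.inr f ∧ f (ρ i) = 3 := by
    intro i hi
    induction i, hi using Nat.le_induction with
    | base =>
      obtain ⟨f, hf, h2⟩ := two j hj
      obtain rfl : f1 = f := by rw [hf1] at hf; exact Sum.inr.inj hf
      refine ⟨_, step j f1 hf1, ?_⟩
      rw [val j (by omega) f1 hf1, if_pos (Or.inl h2), if_pos (Or.inl hempty)]
    | succ i hi ih =>
      obtain ⟨f, hf, h3⟩ := ih
      refine ⟨_, step i f hf, ?_⟩
      rw [val i (by omega) f hf, if_pos (Or.inl (by rw [h3]; decide)), if_pos (Or.inr h3)]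
  obtain ⟨l, hl, f2, hf2, hempty2⟩ := hacc (j + 1)
  obtain ⟨f, hf, h3⟩ := three l hl
  rw [hf2] at hf
  cases hf
  exact hempty2 _ h3

theorem ultra_choose {α : Type} [Finite α] (U : Ultrafilter ℕ) (g : ℕ → α) :
    ∃ b, ∀ᶠ j in (U : Filter ℕ), g j = b := by
  have : ∀ᶠ j in (U : Filter ℕ), ∃ b, g j = b := Filter.Eventually.of_forall fun j => ⟨_, rfl⟩
  exact (Ultrafilter.eventually_exists_iff).1 this

/-- The second phase sequence starting after level `K`. -/
noncomputable def fSeq (A : NBW σ Q) (w : ℕ → σ) (K : ℕ) : ℕ → Q → Fin 4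
  | 0 => fInd A.init
  | i + 1 => if i ≤ K then fInd (A.fReach w (i + 1)) else A.fNext (fSeq A w K i) (w i)

theorem fSeq_supp (A : NBW σ Q) (w : ℕ → σ) (K i : ℕ) :
    {q | A.fSeq w K i q ≠ 0} = A.fReach w i := by
  induction i with
  | zero => exact fInd_supp _
  | succ i ih =>
    by_cases h : i ≤ K
    · simp only [fSeq, h, if_true]; exact fInd_supp _
    · simp only [fSeq, h, if_false]; rw [fNext_supp, ih]; rfl

theorem fSeq_two (A : NBW σ Q) (w : ℕ → σ) (K i : ℕ) : ∀ q, 2 ≤ A.fSeq w K i q →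
    ∃ i', K < i' ∧ i' ≤ i ∧ A.fPath w i q i' ∈ A.acc := by
  induction i with
  | zero =>
    intro q h
    exfalso
    by_cases hq : q ∈ A.init <;> simp [fSeq, fInd, hq] at h
  | succ i ih =>
    intro q h
    by_cases hK : i ≤ K
    · exfalso
      by_cases hq : q ∈ A.fReach w (i + 1) <;> simp [fSeq, fInd, hq, hK] at h
    · simp only [fSeq, hK, if_false, fNext, fSeq_supp] at h
      split_ifs at h with h1 h2 h3
      · rcases h2 with h2 | h2
        · obtain ⟨i', a, b, c⟩ := ih _ h2
          exact ⟨i', a, by omega, by simpa [fPath, b] using c⟩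
        · exact ⟨i + 1, by omega, le_rfl, by rwa [fPath_self]⟩
      · rcases h2 with h2 | h2
        · obtain ⟨i', a, b, c⟩ := ih _ h2
          exact ⟨i', a, by omega, by simpa [fPath, b] using c⟩
        · exact ⟨i + 1, by omega, le_rfl, by rwa [fPath_self]⟩
      · exact absurd h (by decide)
      · exact absurd h (by decide)

theorem comp_complete (A : NBW σ Q) [Finite Q] {w : ℕ → σ}
    (hw : w ∉ A.Lang) : w ∈ A.fComp.Lang := by
  let U : Ultrafilter ℕ := Filter.hyperfilter ℕ
  have hU : ∀ n, ∀ᶠ j in (U : Filter ℕ), n ≤ j := by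
    intro n
    have h1 : (U : Filter ℕ) ≤ Filter.atTop := by
      rw [← Nat.cofinite_eq_atTop]; exact Filter.hyperfilter_le_cofinite
    exact h1 (Filter.eventually_ge_atTop n)
  choose b hb using fun q i => ultra_choose U (fun j => A.fPath w j q i)
  have hfin : ∀ q, ∃ n, (∀ᶠ j in (U : Filter ℕ), q ∈ A.fReach w j) → ∀ m, n ≤ m → b q m ∉ A.acc := by
    intro q
    by_contra hcon
    push Not at hcon
    have hq := (hcon 0).1
    apply hw
    refine ⟨b q, ⟨?_, ?_⟩, fun n => (hcon n).2⟩
    · obtain ⟨j, h1, h2⟩ := (hq.and (hb q 0)).exists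
      rw [← h2]
      exact A.fPath_mem w j q h1 0 (Nat.zero_le _)
    · intro i
      obtain ⟨j, h1, h2, h3, h4⟩ := (hq.and ((hb q i).and ((hb q (i + 1)).and (hU (i + 1))))).exists
      rw [← h2, ← h3]
      exact A.fPath_trans w j q h1 i h4
  choose n hn using hfin
  obtain ⟨K, hK⟩ : ∃ K, ∀ q, n q ≤ K := by
    obtain ⟨K, hK⟩ := (Set.finite_range n).bddAbove
    exact ⟨K, fun q => hK ⟨q, rfl⟩⟩
  refine ⟨fun i => if i ≤ K then Sum.inl (A.fReach w i) else Sum.inr (A.fSeq w K i),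
    ⟨?_, ?_⟩, ?_⟩
  · simp [fComp, fReach]
  · intro i
    by_cases h : i + 1 ≤ K
    · have h' : i ≤ K := by omega
      simp only [h, h', if_true]
      exact Or.inl rfl
    · by_cases h' : i ≤ K
      · simp only [h, h', if_true, if_false, fSeq]
        exact Or.inr rfl
      · simp only [h, h', if_false, fSeq]
        exact rfl
  · intro N
    by_contra hcon
    push Not at hcon
    let m := max N (K + 1)
    have hne : ∀ i ≥ m, ∃ q, A.fSeq w K i q = 3 := by
      intro i hi
      by_contra hno
      push Not at hno
      apply hcon i (le_trans (le_max_left _ _) hi)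
      have : ¬ i ≤ K := by have := le_trans (le_max_right N (K + 1)) hi; omega
      simp only [this, if_false]
      exact ⟨_, rfl, hno⟩
    have desc : ∀ i ≥ m, ∀ q, A.fSeq w K i q = 3 →
        ∃ i', K < i' ∧ i' ≤ m ∧ A.fPath w i q i' ∈ A.acc := by
      intro i hi
      induction i, hi using Nat.le_induction with
      | base => intro q hq; exact A.fSeq_two w K m q (by rw [hq]; decide)
      | succ i hi ih =>
        intro q hq
        have hiK : ¬ i ≤ K := by have := le_trans (le_max_right N (K + 1)) hi; omega
        simp only [fSeq, hiK, if_false, fNext, fSeq_supp] at hq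
        split_ifs at hq with h1 h2 h3
        · rcases h3 with h3 | h3
          · obtain ⟨p, hp⟩ := hne i hi
            exact absurd hp (h3 p)
          · obtain ⟨i', a, b, c⟩ := ih _ h3
            have : i' ≤ i := le_trans b hi
            exact ⟨i', a, b, by simpa [fPath, this] using c⟩
        all_goals exact absurd hq (by decide)
    have hev : ∀ᶠ i in (U : Filter ℕ), ∃ q, q ∈ A.fReach w i ∧
        ∃ i', K < i' ∧ i' ≤ m ∧ A.fPath w i q i' ∈ A.acc := by
      filter_upwards [hU m] with i hi
      obtain ⟨q, hq⟩ := hne i hi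
      refine ⟨q, ?_, desc i hi q hq⟩
      rw [← A.fSeq_supp w K i]
      show A.fSeq w K i q ≠ 0
      rw [hq]; decide
    obtain ⟨q, hq⟩ := (Ultrafilter.eventually_exists_iff).1 hev
    have hall : ∀ᶠ i in (U : Filter ℕ), ∀ i' ∈ Set.Iic m, A.fPath w i q i' = b q i' :=
      (Filter.eventually_all_finite (Set.finite_Iic m)).2 fun i' _ => hb q i'
    obtain ⟨i, ⟨-, i', h1, h2, h3⟩, h4⟩ := (hq.and hall).exists
    rw [h4 i' h2] at h3
    exact hn q (hq.mono fun _ h => h.1) i' (le_trans (hK q) h1.le) h3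

theorem relabel {P : Type} [Fintype P] (B : NBW σ P) :
    ∃ C : NBW σ (Fin (Fintype.card P)), C.Lang = B.Lang := by
  let e := Fintype.equivFin P
  refine ⟨⟨{x | e.symm x ∈ B.init}, fun x a => {y | e.symm y ∈ B.trans (e.symm x) a},
    {x | e.symm x ∈ B.acc}⟩, ?_⟩
  ext w
  constructor
  · rintro ⟨ρ, h⟩
    exact ⟨fun i => e.symm (ρ i), h⟩
  · rintro ⟨ρ, ⟨h1, h2⟩, h3⟩
    refine ⟨fun i => e (ρ i), ⟨?_, ?_⟩, ?_⟩
    · simpa using h1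
    · simpa using h2
    · simpa using h3

end NBW

/-- Every complete finitely ambiguous NBW with `n` states has a complementary NBW
with at most `6 ^ n` states. -/
theorem NBW.fanbw_complement_rank (σ Q : Type) [Fintype σ] [Nonempty σ] [Fintype Q]
    (A : NBW σ Q) (hc : A.Complete) (hfa : A.FinitelyAmbiguous) :
    ∃ (m : ℕ) (B : NBW σ (Fin m)), m ≤ 6 ^ Fintype.card Q ∧
      B.Lang = Set.univ \ A.Lang := by
  rcases isEmpty_or_nonempty Q with hQ | hQ
  · refine ⟨1, ⟨Set.univ, fun _ _ => Set.univ, Set.univ⟩, Nat.one_le_pow _ _ (by norm_num), ?_⟩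
    ext w
    constructor
    · intro _
      refine ⟨trivial, ?_⟩
      rintro ⟨ρ, -⟩
      exact hQ.elim (ρ 0)
    · intro _
      exact ⟨fun _ => 0, ⟨trivial, fun _ => trivial⟩, fun n => ⟨n, le_rfl, trivial⟩⟩
  · obtain ⟨C, hC⟩ := NBW.relabel A.fComp
    refine ⟨_, C, ?_, ?_⟩
    · rw [Fintype.card_sum, Fintype.card_set, Fintype.card_fun, Fintype.card_fin]
      obtain ⟨k, hk⟩ : ∃ k, Fintype.card Q = k + 1 :=
        ⟨Fintype.card Q - 1, by have := Fintype.card_pos (α := Q); omega⟩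
      rw [hk, pow_succ, pow_succ, pow_succ]
      have h1 : 2 ^ k ≤ 6 ^ k := Nat.pow_le_pow_left (by norm_num) k
      have h2 : 4 ^ k ≤ 6 ^ k := Nat.pow_le_pow_left (by norm_num) k
      omega
    · rw [hC]
      ext w
      constructor
      · intro h
        exact ⟨trivial, A.comp_sound hfa h⟩
      · intro h
        exact A.comp_complete h.2
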